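/- Let s ≡ 2 (mod 4) be square-free with s ≥ 10 and 7 ∤ s, and K = Q(√7, √s) with ring of integers O_K having integral basis (1, √7, √s, (√s+√(7s))/2). Then α = 1² + 1² + 1² + (1+√7)² + ((√s+√(7s))/2)² + (1+(√s+√(7s))/2)² has length exactly 6 in O_K; in particular P(O_K) ≥ 6. -/

import Mathlib

open scoped Classical

noncomputable section

/-- `α` is a sum of `n` squares of elements of `S ⊆ ℝ`. -/
def SumOfSquaresLen (S : Set ℝ) (n : ℕ) (α : ℝ) : Prop :=
  ∃ x : Fin n → ℝ, (∀ i, x i ∈ S) ∧ α = ∑ i, x i ^ 2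

/-- The length of `α` as a sum of squares of elements of `S` (∞ if not a sum of squares). -/
def sqLength (S : Set ℝ) (α : ℝ) : ℕ∞ :=
  sInf {n : ℕ∞ | ∃ k : ℕ, n = (k : ℕ∞) ∧ SumOfSquaresLen S k α}

/-- The Pythagoras number of `S ⊆ ℝ`. -/
def pythagorasNumber (S : Set ℝ) : ℕ∞ :=
  sSup {n : ℕ∞ | ∃ α : ℝ, (∃ k : ℕ, SumOfSquaresLen S k α) ∧ n = sqLength S α}

/-- The biquadratic field `ℚ(√p, √q)` as a subfield of `ℝ`. -/
def biquadField (p q : ℝ) : IntermediateField ℚ ℝ :=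
  IntermediateField.adjoin ℚ {Real.sqrt p, Real.sqrt q}

/-- The ring of integers of `ℚ(√p, √q)`, viewed as a subset of `ℝ`. -/
def ringOfInt (p q : ℝ) : Set ℝ :=
  {x : ℝ | x ∈ biquadField p q ∧ IsIntegral ℤ x}


lemma core_tail (a2 a3 a4 b2 b3 b4 n : ℤ) (hn : n = 1 ∨ 5 ≤ n)
    (hN : n + a2^2 + a3^2 + a4^2 + 7*(b2^2+b3^2+b4^2) = 12)
    (hR : a2*b2+a3*b3+a4*b4 = 1) (h2 : b2 ≠ 0) : False := by
  have hn1 : 1 ≤ n := by omega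
  have hb2 : 1 ≤ b2^2 := by have := sq_pos_of_ne_zero h2; omega
  have hb3 : b3 = 0 := by
    by_contra h
    have := sq_pos_of_ne_zero h
    linarith [sq_nonneg a2, sq_nonneg a3, sq_nonneg a4, sq_nonneg b4]
  have hb4 : b4 = 0 := by
    by_contra h
    have := sq_pos_of_ne_zero h
    linarith [sq_nonneg a2, sq_nonneg a3, sq_nonneg a4, sq_nonneg b3]
  subst hb3 hb4
  have h1 : a2 * b2 = 1 := by linarith
  have ha2 : a2^2 = 1 ∧ b2^2 = 1 := by
    rcases Int.mul_eq_one_iff_eq_one_or_neg_one.1 h1 with ⟨h, h'⟩ | ⟨h, h'⟩ <;> simp [h, h']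
  have h3 : n + a3^2 + a4^2 = 4 := by linarith [ha2.1, ha2.2]
  rcases hn with hn | hn
  · have ha3 : a3 ≤ 1 := by nlinarith [sq_nonneg a4]
    have ha3' : -1 ≤ a3 := by nlinarith [sq_nonneg a4]
    have ha4 : a4 ≤ 1 := by nlinarith [sq_nonneg a3]
    have ha4' : -1 ≤ a4 := by nlinarith [sq_nonneg a3]
    subst hn
    interval_cases a3 <;> interval_cases a4 <;> omega
  · nlinarith [sq_nonneg a3, sq_nonneg a4]

lemma sq_one_cases {x : ℤ} (h : x^2 = 1) : x = 1 ∨ x = -1 := by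
  have : (x-1)*(x+1) = 0 := by linarith
  rcases mul_eq_zero.1 this with h | h <;> omega

lemma key_odd : ∀ c d : ℤ, d % 2 = 1 → 2 ≤ 2*d^2+c*d+c^2 ∧ (2*d^2+c*d+c^2 ≤ 2 → d^2 = 1 ∧ (d+2*c)^2 = 1) := by
  intro c d hd
  have hd1 : 1 ≤ d^2 := by
    have : d ≠ 0 := by omega
    have := sq_pos_of_ne_zero this
    omega
  have hd2 : 1 ≤ (d+2*c)^2 := by
    have : d+2*c ≠ 0 := by omega
    have := sq_pos_of_ne_zero this
    omega
  constructor
  · nlinarith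
  · intro h
    constructor <;> nlinarith

lemma key_nn : ∀ c d : ℤ, 0 ≤ 2*d^2+c*d+c^2 ∧ (2*d^2+c*d+c^2 ≤ 0 → d = 0 ∧ c = 0) := by
  intro c d
  constructor
  · nlinarith [sq_nonneg (d+2*c), sq_nonneg d]
  · intro h
    have hd : d = 0 := by
      by_contra hd
      have := sq_pos_of_ne_zero hd
      nlinarith [sq_nonneg (d+2*c)]
    subst hd
    refine ⟨rfl, ?_⟩
    by_contra hd
    have := sq_pos_of_ne_zero hd
    nlinarith

lemma key_nb : ∀ a b : ℤ, 5 * (a*b) ≤ a^2+7*b^2 := by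
  intro a b; nlinarith [sq_nonneg (2*a-5*b), sq_nonneg b]

set_option maxHeartbeats 2000000 in
lemma core2 (s : ℤ) (hs : 10 ≤ s) (hs4 : s % 4 = 2)
    (a0 a1 a2 a3 a4 b0 b1 b2 b3 b4 c0 c1 c2 c3 c4 d0 d1 d2 d3 d4 : ℤ)
    (h1 : (a0^2+7*b0^2) + (a1^2+7*b1^2) + (a2^2+7*b2^2) + (a3^2+7*b3^2) + (a4^2+7*b4^2)
      + s * ((2*d0^2+c0*d0+c0^2) + (2*d1^2+c1*d1+c1^2) + (2*d2^2+c2*d2+c2^2)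
        + (2*d3^2+c3*d3+c3^2) + (2*d4^2+c4*d4+c4^2)) = 12 + 4 * s)
    (h2 : 4 * (a0*b0+a1*b1+a2*b2+a3*b3+a4*b4) + s * ((d0+2*c0)*d0+(d1+2*c1)*d1+(d2+2*c2)*d2
      +(d3+2*c3)*d3+(d4+2*c4)*d4) = 4 + 2 * s)
    (h3 : (a0*(d0+2*c0)+7*b0*d0)+(a1*(d1+2*c1)+7*b1*d1)+(a2*(d2+2*c2)+7*b2*d2)
      +(a3*(d3+2*c3)+7*b3*d3)+(a4*(d4+2*c4)+7*b4*d4) = 1)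
    (h4 : (a0*d0+b0*(d0+2*c0))+(a1*d1+b1*(d1+2*c1))+(a2*d2+b2*(d2+2*c2))
      +(a3*d3+b3*(d3+2*c3))+(a4*d4+b4*(d4+2*c4)) = 1)
    (ho0 : d0 % 2 = 1) (ho1 : d1 % 2 = 1) : False := by
  have na : ∀ a b : ℤ, 0 ≤ a^2+7*b^2 := by intro a b; positivity
  obtain ⟨k0, k0'⟩ := key_odd c0 d0 ho0
  obtain ⟨k1, k1'⟩ := key_odd c1 d1 ho1
  obtain ⟨n2, n2'⟩ := key_nn c2 d2
  obtain ⟨n3, n3'⟩ := key_nn c3 d3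
  obtain ⟨n4, n4'⟩ := key_nn c4 d4
  have p0 := na a0 b0
  have p1 := na a1 b1
  have p2 := na a2 b2
  have p3 := na a3 b3
  have p4 := na a4 b4
  have q0 := key_nb a0 b0
  have q1 := key_nb a1 b1
  have q2 := key_nb a2 b2
  have q3 := key_nb a3 b3
  have q4 := key_nb a4 b4
  obtain ⟨M, hM⟩ : ∃ M, M = ((2*d0^2+c0*d0+c0^2) + (2*d1^2+c1*d1+c1^2) + (2*d2^2+c2*d2+c2^2)
        + (2*d3^2+c3*d3+c3^2) + (2*d4^2+c4*d4+c4^2)) := ⟨_, rfl⟩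
  obtain ⟨N, hN⟩ : ∃ N, N = (a0^2+7*b0^2) + (a1^2+7*b1^2) + (a2^2+7*b2^2) + (a3^2+7*b3^2) + (a4^2+7*b4^2) := ⟨_, rfl⟩
  rw [← hM, ← hN] at h1
  have hM4 : 4 ≤ M := by linarith
  have hN0 : 0 ≤ N := by linarith
  have hM5 : M ≤ 5 := by
    clear q0 q1 q2 q3 q4 p0 p1 p2 p3 p4 k0' k1' n2' n3' n4' k0 k1 n2 n3 n4 h2 h3 h4 hM hN
    nlinarith
  have hM' : M = 4 ∨ M = 5 := by omega
  rcases hM' with rfl | rfl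
  swap
  · have hs10 : s = 10 := by omega
    subst hs10
    have hN2 : N = 2 := by omega
    have z : ∀ a b : ℤ, a^2+7*b^2 ≤ 2 → b = 0 := by
      intro a b h
      by_contra hb
      have := sq_pos_of_ne_zero hb
      linarith [sq_nonneg a]
    have z0 := z a0 b0 (by linarith)
    have z1 := z a1 b1 (by linarith)
    have z2 := z a2 b2 (by linarith)
    have z3 := z a3 b3 (by linarith)
    have z4 := z a4 b4 (by linarith)
    subst z0 z1 z2 z3 z4
    omega
  · have hN12 : N = 12 := by linarith
    obtain ⟨u0, v0⟩ := k0' (by linarith)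
    obtain ⟨u1, v1⟩ := k1' (by linarith)
    obtain ⟨rfl, rfl⟩ := n2' (by linarith)
    obtain ⟨rfl, rfl⟩ := n3' (by linarith)
    obtain ⟨rfl, rfl⟩ := n4' (by linarith)
    have sg : ∀ e d : ℤ, d^2 = 1 → e^2 = 1 → e = d ∨ e * d = -1 := by
      intro e d hd he
      rcases sq_one_cases he with rfl | rfl <;> rcases sq_one_cases hd with rfl | rfl <;> simp
    have hR : a0*b0+a1*b1+a2*b2+a3*b3+a4*b4 ≤ 2 := by omega
    have w0 : d0 + 2*c0 = d0 := by
      rcases sg _ _ u0 v0 with h | h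
      · exact h
      · have h5 : (d1+2*c1)*d1 ≤ 1 := by
          linarith [sq_nonneg (d1+2*c1-d1), u1, v1]
        have h6 := mul_nonneg (show (0:ℤ) ≤ s by linarith) (show 0 ≤ 1 - (d1+2*c1)*d1 by linarith)
        have h7 : s * ((d0+2*c0)*d0) = -s := by rw [h]; ring
        linarith
    have w1 : d1 + 2*c1 = d1 := by
      rcases sg _ _ u1 v1 with h | h
      · exact h
      · have h5 : (d0+2*c0)*d0 ≤ 1 := by
          linarith [sq_nonneg (d0+2*c0-d0), u0, v0]
        have h6 := mul_nonneg (show (0:ℤ) ≤ s by linarith) (show 0 ≤ 1 - (d0+2*c0)*d0 by linarith)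
        have h7 : s * ((d1+2*c1)*d1) = -s := by rw [h]; ring
        linarith
    obtain rfl : c0 = 0 := by omega
    obtain rfl : c1 = 0 := by omega
    have hA : d0*a0+d1*a1 = 1 := by linarith
    have hB : d0*b0+d1*b1 = 0 := by linarith
    have hbb : b0^2 = b1^2 := by
      have e1 : (d0*b0)^2 = (d1*b1)^2 := by
        have : d0*b0 = -(d1*b1) := by linarith
        rw [this]; ring
      rw [mul_pow, mul_pow, u0, u1] at e1
      linarith
    obtain rfl : b0 = 0 := by
      by_contra hb
      have := sq_pos_of_ne_zero hb
      linarith [sq_nonneg a0, sq_nonneg a1]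
    obtain rfl : b1 = 0 := by
      by_contra hb
      have := sq_pos_of_ne_zero hb
      linarith [sq_nonneg a0, sq_nonneg a1]
    have hR1 : a2*b2+a3*b3+a4*b4 = 1 := by
      have : s * ((d0+2*0)*d0+(d1+2*0)*d1) = s * (d0^2+d1^2) := by ring
      rw [u0, u1] at this
      linarith
    have hn : a0^2+a1^2 = 1 ∨ 5 ≤ a0^2+a1^2 := by
      have e1 : (d0*a0)^2 = a0^2 := by rw [mul_pow, u0, one_mul]
      have e2 : (d1*a1)^2 = a1^2 := by rw [mul_pow, u1, one_mul]
      rw [← e1, ← e2]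
      have : d1*a1 = 1 - d0*a0 := by linarith
      rw [this]
      generalize d0*a0 = x
      have : x ≤ -1 ∨ x = 0 ∨ x = 1 ∨ 2 ≤ x := by omega
      rcases this with h | rfl | rfl | h
      · right; clear * - h; nlinarith
      · left; norm_num
      · left; norm_num
      · right; clear * - h; nlinarith
    by_cases hb2 : b2 = 0
    · by_cases hb3 : b3 = 0
      · by_cases hb4 : b4 = 0
        · subst hb2 hb3 hb4; omega
        · exact core_tail a4 a3 a2 b4 b3 b2 _ hn (by linarith) (by linarith) hb4
      · exact core_tail a3 a2 a4 b3 b2 b4 _ hn (by linarith) (by linarith) hb3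
    · exact core_tail a2 a3 a4 b2 b3 b4 _ hn (by linarith) (by linarith) hb2

lemma perm_exists : ∀ i j : Fin 5, i ≠ j → ∃ σ : Equiv.Perm (Fin 5), σ 0 = i ∧ σ 1 = j := by
  intro i j hij
  refine ⟨Equiv.swap 0 i * Equiv.swap 1 (Equiv.swap 0 i j), ?_⟩
  revert i j
  decide

lemma core5 (s : ℤ) (hs : 10 ≤ s) (hs4 : s % 4 = 2) (a b c d : Fin 5 → ℤ)
    (h1 : ∑ i, (a i^2+7*b i^2) + s * ∑ i, (2*d i^2+c i*d i+c i^2) = 12 + 4 * s)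
    (h2 : 4 * ∑ i, a i * b i + s * ∑ i, (d i+2*c i)*d i = 4 + 2 * s)
    (h3 : ∑ i, (a i*(d i+2*c i)+7*b i*d i) = 1)
    (h4 : ∑ i, (a i*d i+b i*(d i+2*c i)) = 1) : False := by
  obtain ⟨i, hi⟩ : ∃ i, d i % 2 = 1 := by
    by_contra! h
    have : (2:ℤ) ∣ ∑ i, (a i*(d i+2*c i)+7*b i*d i) := by
      apply Finset.dvd_sum
      intro i _
      obtain ⟨k, hk⟩ : (2:ℤ) ∣ d i := by have := h i; omega
      rw [hk]
      exact ⟨a i * (k + c i) + 7 * b i * k, by ring⟩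
    omega
  obtain ⟨j, hij, hj⟩ : ∃ j, i ≠ j ∧ d j % 2 = 1 := by
    by_contra! h
    have hd : (2:ℤ) ∣ ∑ l ∈ Finset.univ.erase i, (d l+2*c l)*d l := by
      apply Finset.dvd_sum
      intro l hl
      have : (2:ℤ) ∣ d l := by
        have := h l (Finset.ne_of_mem_erase hl).symm
        omega
      exact Dvd.dvd.mul_left this _
    rw [← Finset.add_sum_erase _ (fun l => (d l+2*c l)*d l) (Finset.mem_univ i)] at h2
    obtain ⟨k, hk⟩ := hd
    rw [hk] at h2
    obtain ⟨m, hm⟩ : ∃ m, s = 4 * m + 2 := ⟨s / 4, by omega⟩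
    obtain ⟨n, hn⟩ : ∃ n, d i = 2 * n + 1 := ⟨d i / 2, by omega⟩
    simp only [hn, hm] at h2
    generalize ∑ i, a i * b i = R at h2
    have : (4:ℤ) * (R + m * (((2 * n + 1 + 2 * c i) * (2 * n + 1) + 2 * k))
      + (2*n^2+2*n + 2 * c i * n + c i + k) - 1 - 2 * m - 1) = -2  := by linarith
    omega
  obtain ⟨σ, hσ0, hσ1⟩ := perm_exists i j hij
  rw [← Equiv.sum_comp σ, ← Equiv.sum_comp σ (fun i => (2*d i^2+c i*d i+c i^2))] at h1
  rw [← Equiv.sum_comp σ, ← Equiv.sum_comp σ (fun i => (d i+2*c i)*d i)] at h2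
  rw [← Equiv.sum_comp σ] at h3 h4
  simp only [Fin.sum_univ_five] at h1 h2 h3 h4
  exact core2 s hs hs4 _ _ _ _ _ _ _ _ _ _ _ _ _ _ _ _ _ _ _ _ h1 h2 h3 h4
    (by rw [hσ0]; exact hi) (by rw [hσ1]; exact hj)

/-- The general element `p + q w + r z + t w z`. -/
def bqForm (w z : ℝ) (p q r t : ℚ) : ℝ := p + q * w + r * z + t * (w * z)

lemma bq_mul (s : ℕ) (p q r t p' q' r' t' : ℚ) : ∃ A B C D : ℚ, ∀ w z : ℝ, w^2 = 7 → z^2 = s →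
    bqForm w z p q r t * bqForm w z p' q' r' t' = bqForm w z A B C D := by
  refine ⟨p*p' + 7*q*q' + s*r*r' + 7*s*t*t', p*q'+q*p'+s*r*t'+s*t*r',
    p*r'+r*p'+7*q*t'+7*t*q', p*t'+t*p'+q*r'+r*q', ?_⟩
  intro w z hw hz
  simp only [bqForm]
  push_cast
  rw [← hz, ← hw]
  ring

lemma bq_poly (s : ℕ) (f : Polynomial ℤ) (p q r t : ℚ) : ∃ A B C D : ℚ, ∀ w z : ℝ, w^2 = 7 → z^2 = s →
    Polynomial.aeval (bqForm w z p q r t) f = bqForm w z A B C D := by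
  induction f using Polynomial.induction_on' with
  | add f g hf hg =>
    obtain ⟨A, B, C, D, h⟩ := hf
    obtain ⟨A', B', C', D', h'⟩ := hg
    refine ⟨A+A', B+B', C+C', D+D', ?_⟩
    intro w z hw hz
    rw [map_add, h w z hw hz, h' w z hw hz]
    simp only [bqForm]
    push_cast
    ring
  | monomial n a =>
    induction n with
    | zero =>
      refine ⟨a, 0, 0, 0, ?_⟩
      intro w z hw hz
      simp [bqForm]
    | succ n ih =>
      obtain ⟨A, B, C, D, h⟩ := ih
      obtain ⟨A', B', C', D', h'⟩ := bq_mul s A B C D p q r t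
      refine ⟨A', B', C', D', ?_⟩
      intro w z hw hz
      rw [← h' w z hw hz, ← h w z hw hz]
      simp [Polynomial.aeval_monomial, pow_succ, mul_assoc]

lemma irr_lin (m : ℕ) (hm : Squarefree m) (hm1 : 1 < m) (y : ℝ) (hy : y^2 = m) (p q : ℚ)
    (h : (p:ℝ) + q * y = 0) : p = 0 ∧ q = 0 := by
  have hirr : ∀ v : ℚ, (v:ℝ) ≠ y := by
    intro v hv
    have h1 : v^2 = m := by
      have : (v:ℝ)^2 = m := by rw [hv, hy]
      exact_mod_cast this
    have : IsSquare (m:ℚ) := ⟨v, by rw [← h1]; ring⟩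
    rw [Rat.isSquare_natCast_iff] at this
    obtain ⟨k, hk⟩ := this
    have := hm k ⟨1, by rw [hk]; ring⟩
    rw [Nat.isUnit_iff] at this
    subst this
    omega
  have hq : q = 0 := by
    by_contra hq
    apply hirr (-p/q)
    have : (q:ℝ) ≠ 0 := by exact_mod_cast hq
    push_cast
    field_simp
    linarith
  subst hq
  simpa using h

lemma bq_indep (s : ℕ) (hs : Squarefree s) (hs1 : 1 < s) (h7s : Squarefree (7 * s)) (w z : ℝ)
    (hw : w^2 = 7) (hz : z^2 = s) (p q r t : ℚ) (h : bqForm w z p q r t = 0) :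
    p = 0 ∧ q = 0 ∧ r = 0 ∧ t = 0 := by
  have sq7 : Squarefree 7 := (by norm_num : Nat.Prime 7).prime.squarefree
  have irr7 := irr_lin 7 sq7 (by norm_num) w (by simpa using hw)
  have irrs := irr_lin s hs hs1 z hz
  have irr7s := irr_lin (7*s) h7s (by omega) (w*z) (by rw [mul_pow, hw, hz]; push_cast; ring)
  unfold bqForm at h
  have hrt : r^2 - 7*t^2 = 0 := by
    by_contra hN
    -- N z = A + B w
    have e1 : ((r^2-7*t^2 : ℚ):ℝ) * z = (-(p*r-7*q*t) : ℚ) + (-(q*r-p*t) : ℚ) * w := by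
      push_cast
      linear_combination ((r:ℝ) - t * w) * h + (t^2*z+q*t) * hw
    generalize hNN : r^2-7*t^2 = N at *
    generalize -(p*r-7*q*t) = A at *
    generalize -(q*r-p*t) = B at *
    have e2 : ((N^2*s - A^2-7*B^2 : ℚ):ℝ) + (-2*A*B : ℚ) * w = 0 := by
      push_cast
      linear_combination (N * z + A + B * w) * e1 - N^2 * hz + B^2 * hw
    have h2 := (irr7 _ _ e2).2
    have h3 : A = 0 ∨ B = 0 := by simpa using h2
    rcases h3 with rfl | rfl
    · apply hN
      have e3 : ((-7*B : ℚ):ℝ) + (N:ℚ) * (w*z) = 0 := by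
        push_cast
        push_cast at e1
        linear_combination w * e1 + B * hw
      exact (irr7s _ _ e3).2
    · apply hN
      have e3 : ((-A : ℚ):ℝ) + (N:ℚ) * z = 0 := by
        push_cast
        push_cast at e1
        linear_combination e1
      exact (irrs _ _ e3).2
  have e4 : ((r^2-7*t^2 : ℚ):ℝ) = (r - t * w) * (r + t * w) := by
    push_cast; linear_combination (t^2:ℝ) * hw
  have hrt' : r = 0 ∧ t = 0 := by
    rw [hrt] at e4
    rcases mul_eq_zero.1 (e4.symm.trans (by simp)) with h' | h'
    · have := irr7 r (-t) (by push_cast; linarith)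
      exact ⟨this.1, by simpa using this.2⟩
    · exact irr7 r t h'
  obtain ⟨rfl, rfl⟩ := hrt'
  have := irr7 p q (by simpa using h)
  exact ⟨this.1, this.2, rfl, rfl⟩

lemma bq_conj (s : ℕ) (hs : Squarefree s) (hs1 : 1 < s) (h7s : Squarefree (7 * s)) (w z : ℝ)
    (hw : w^2 = 7) (hz : z^2 = s) (p q r t : ℚ) (h : IsIntegral ℤ (bqForm w z p q r t))
    (w' z' : ℝ) (hw' : w'^2 = 7) (hz' : z'^2 = s) : IsIntegral ℤ (bqForm w' z' p q r t) := by
  obtain ⟨f, hf, hf0⟩ := h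
  obtain ⟨A, B, C, D, hA⟩ := bq_poly s f p q r t
  refine ⟨f, hf, ?_⟩
  rw [← Polynomial.aeval_def] at hf0 ⊢
  rw [hA w z hw hz] at hf0
  obtain ⟨rfl, rfl, rfl, rfl⟩ := bq_indep s hs hs1 h7s w z hw hz _ _ _ _ hf0
  rw [hA w' z' hw' hz']
  simp [bqForm]

lemma isInt_congr {x y : ℝ} (h : IsIntegral ℤ x) (e : y = x) : IsIntegral ℤ y := by
  rw [e]; exact h

lemma rat_int (q : ℚ) (h : IsIntegral ℤ (q:ℝ)) : ∃ n : ℤ, q = n := by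
  have h' : IsIntegral ℤ q := by
    have : (q:ℝ) = algebraMap ℚ ℝ q := by simp
    rw [this] at h
    exact (isIntegral_algebraMap_iff (algebraMap ℚ ℝ).injective).1 h
  obtain ⟨n, hn⟩ := IsIntegrallyClosed.isIntegral_iff.1 h'
  exact ⟨n, by simpa using hn.symm⟩

lemma sqfree_rat (m : ℕ) (hm : Squarefree m) (v : ℚ) (n : ℤ) (h : m * v^2 = n) :
    ∃ k : ℤ, v = k := by
  have hd : (v.den : ℚ) ≠ 0 := by exact_mod_cast v.den_nz
  have h1 : (m:ℚ) * v.num^2 = n * v.den^2 := by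
    rw [← h]
    nth_rewrite 2 [← Rat.num_div_den v]
    field_simp
  have h2 : (m:ℤ) * v.num^2 = n * v.den^2 := by exact_mod_cast h1
  have h3 : (v.den:ℤ)^2 ∣ m := by
    have hc : IsCoprime ((v.den:ℤ)^2) (v.num^2) := by
      apply IsCoprime.pow
      rw [Int.isCoprime_iff_gcd_eq_one]
      have := v.reduced
      rw [Nat.coprime_comm] at this
      simpa [Int.gcd] using this
    exact hc.dvd_of_dvd_mul_right ⟨n, by rw [h2]; ring⟩
  have h4 : v.den^2 ∣ m := by exact_mod_cast h3
  have h5 := hm v.den (by rw [← sq]; exact h4)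
  rw [Nat.isUnit_iff] at h5
  exact ⟨v.num, (Rat.den_eq_one_iff v).1 h5 |>.symm⟩

lemma quad_int (m : ℕ) (hm : Squarefree m) (hm4 : m % 4 = 2 ∨ m % 4 = 3) (y : ℝ) (hy : y^2 = m)
    (P Q : ℚ) (h1 : IsIntegral ℤ ((P:ℝ) + Q * y)) (h2 : IsIntegral ℤ ((P:ℝ) - Q * y)) :
    (∃ n : ℤ, P = n) ∧ ∃ n : ℤ, Q = n := by
  obtain ⟨u, hu⟩ := rat_int (2*P) (by
    have := h1.add h2
    refine isInt_congr (this) ?_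
    push_cast; ring)
  obtain ⟨n, hn⟩ := rat_int (P^2-m*Q^2) (by
    have := h1.mul h2
    refine isInt_congr (this) ?_
    push_cast; rw [← hy]; ring)
  obtain ⟨v, hv⟩ := sqfree_rat m hm (2*Q) (u^2-4*n) (by
    push_cast; rw [← hu, ← hn]; ring)
  have e : (u:ℚ)^2 - m * v^2 = 4 * n := by rw [← hu, ← hv, ← hn]; ring
  have e' : u^2 - m * v^2 = 4 * n := by exact_mod_cast e
  have hev : u % 2 = 0 ∧ v % 2 = 0 := by
    obtain ⟨k, hk⟩ : ∃ k : ℤ, (m:ℤ) = 4 * k + 2 ∨ (m:ℤ) = 4 * k + 3 := ⟨m/4, by omega⟩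
    have hu2 := Int.emod_two_eq_zero_or_one u
    have hv2 := Int.emod_two_eq_zero_or_one v
    obtain ⟨u', hu'⟩ : ∃ u', u' = u / 2 := ⟨_, rfl⟩
    obtain ⟨v', hv'⟩ : ∃ v', v' = v / 2 := ⟨_, rfl⟩
    rcases hu2 with hu2 | hu2 <;> rcases hv2 with hv2 | hv2
    · exact ⟨hu2, hv2⟩
    all_goals exfalso
    · have a1 : u = 2 * u' := by omega
      have a2 : v = 2 * v' + 1 := by omega
      rcases hk with hk | hk <;> rw [a1, a2, hk] at e' <;> ring_nf at e' <;> omega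
    · have a1 : u = 2 * u' + 1 := by omega
      have a2 : v = 2 * v' := by omega
      rcases hk with hk | hk <;> rw [a1, a2, hk] at e' <;> ring_nf at e' <;> omega
    · have a1 : u = 2 * u' + 1 := by omega
      have a2 : v = 2 * v' + 1 := by omega
      rcases hk with hk | hk <;> rw [a1, a2, hk] at e' <;> ring_nf at e' <;> omega
  refine ⟨⟨u/2, ?_⟩, ⟨v/2, ?_⟩⟩
  · have : (u:ℤ) = 2 * (u/2) := by omega
    have : (u:ℚ) = 2 * ((u/2 : ℤ):ℚ) := by exact_mod_cast this
    linarith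
  · have : (v:ℤ) = 2 * (v/2) := by omega
    have : (v:ℚ) = 2 * ((v/2 : ℤ):ℚ) := by exact_mod_cast this
    linarith

lemma bq_int (s : ℕ) (hs4 : s % 4 = 2) (hs : Squarefree s) (h7s : Squarefree (7 * s)) (w z : ℝ)
    (hw : w^2 = 7) (hz : z^2 = s) (p q r t : ℚ) (h : IsIntegral ℤ (bqForm w z p q r t)) :
    ∃ a b c d : ℤ, bqForm w z p q r t = a + b * w + z * (c + d * ((1 + w)/2)) := by
  have sq7 : Squarefree 7 := (by norm_num : Nat.Prime 7).prime.squarefree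
  have hs1 : 1 < s := by omega
  have hw' : (-w)^2 = 7 := by rw [neg_sq, hw]
  have hz' : (-z)^2 = s := by rw [neg_sq, hz]
  have i2 := bq_conj s hs hs1 h7s w z hw hz p q r t h w (-z) hw hz'
  have i3 := bq_conj s hs hs1 h7s w z hw hz p q r t h (-w) z hw' hz
  have i4 := bq_conj s hs hs1 h7s w z hw hz p q r t h (-w) (-z) hw' hz'
  obtain ⟨⟨P, hP⟩, Q, hQ⟩ := quad_int 7 sq7 (by norm_num) w (by simpa using hw) (2*p) (2*q)
    (by refine isInt_congr (h.add i2) ?_; simp only [bqForm]; push_cast; ring)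
    (by refine isInt_congr (i3.add i4) ?_; simp only [bqForm]; push_cast; ring)
  obtain ⟨-, E, hE⟩ := quad_int s hs (by omega) z hz (2*p) (2*r)
    (by refine isInt_congr (h.add i3) ?_; simp only [bqForm]; push_cast; ring)
    (by refine isInt_congr (i2.add i4) ?_; simp only [bqForm]; push_cast; ring)
  obtain ⟨-, D, hD⟩ := quad_int (7*s) h7s (by omega) (w*z)
    (by rw [mul_pow, hw, hz]; push_cast; ring) (2*p) (2*t)
    (by refine isInt_congr (h.add i4) ?_; simp only [bqForm]; push_cast; ring)
    (by refine isInt_congr (i2.add i3) ?_; simp only [bqForm]; push_cast; ring)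
  obtain ⟨⟨U, hU⟩, V, hV⟩ := quad_int 7 sq7 (by norm_num) w (by simpa using hw)
    (p^2+7*q^2-s*(r^2+7*t^2)) (2*p*q-2*s*r*t)
    (by refine isInt_congr (h.mul i2) ?_; simp only [bqForm]; push_cast; rw [← hz]
        linear_combination (z^2*t^2-q^2) * hw)
    (by refine isInt_congr (i3.mul i4) ?_; simp only [bqForm]; push_cast; rw [← hz]
        linear_combination (z^2*t^2-q^2) * hw)
  have e1 : (P:ℚ)^2+7*Q^2-s*(E^2+7*D^2) = 4 * U := by
    rw [← hP, ← hQ, ← hE, ← hD, ← hU]; ring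
  have e2 : (P:ℚ)*Q-s*(E*D) = 2 * V := by
    rw [← hP, ← hQ, ← hE, ← hD, ← hV]; ring
  have e1' : P^2+7*Q^2-s*(E^2+7*D^2) = 4 * U := by exact_mod_cast e1
  have e2' : P*Q-s*(E*D) = 2 * V := by exact_mod_cast e2
  obtain ⟨k, hk⟩ : ∃ k : ℤ, (s:ℤ) = 4 * k + 2 := ⟨s/4, by omega⟩
  rw [hk] at e1' e2'
  have hPQ : ∃ a b, P = 2 * a ∧ Q = 2 * b := by
    obtain ⟨a, ha⟩ := Int.even_or_odd' P
    obtain ⟨b, hb⟩ := Int.even_or_odd' Q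
    rcases ha with ha | ha <;> rcases hb with hb | hb
    · exact ⟨a, b, ha, hb⟩
    all_goals exfalso; rw [ha, hb] at e1' e2'; ring_nf at e1' e2'; omega
  obtain ⟨a, b, rfl, rfl⟩ := hPQ
  have hED : ∃ c, E = D + 2 * c := by
    obtain ⟨x, hx⟩ := Int.even_or_odd' E
    obtain ⟨y, hy⟩ := Int.even_or_odd' D
    rcases hx with hx | hx <;> rcases hy with hy | hy
    · exact ⟨x - y, by omega⟩
    · exfalso; rw [hx, hy] at e1'; ring_nf at e1'; omega
    · exfalso; rw [hx, hy] at e1'; ring_nf at e1'; omega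
    · exact ⟨x - y, by omega⟩
  obtain ⟨c, rfl⟩ := hED
  refine ⟨a, b, c, D, ?_⟩
  have hp : p = a := by push_cast at hP; linarith
  have hq : q = b := by push_cast at hQ; linarith
  have hr : r = D/2 + c := by push_cast at hE; linarith
  have ht : t = D/2 := by linarith
  rw [hp, hq, hr, ht]
  simp only [bqForm]
  push_cast
  ring

lemma bq_field (s : ℕ) (x : ℝ) (hx : x ∈ biquadField 7 (s:ℝ)) :
    ∃ p q r t : ℚ, x = bqForm (Real.sqrt 7) (Real.sqrt s) p q r t := by
  have hw : (Real.sqrt 7)^2 = 7 := Real.sq_sqrt (by norm_num)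
  have hz : (Real.sqrt s)^2 = s := Real.sq_sqrt (by positivity)
  have hx' : x ∈ Algebra.adjoin ℚ ({Real.sqrt 7, Real.sqrt (s:ℝ)} : Set ℝ) := by
    rw [← IntermediateField.adjoin_toSubalgebra_of_isAlgebraic]
    · exact hx
    · intro y hy
      have hint : IsIntegral ℚ y := by
        rcases hy with rfl | rfl
        · apply IsIntegral.of_pow (n := 2) (by norm_num)
          rw [hw]
          exact_mod_cast (isIntegral_algebraMap : IsIntegral ℚ (algebraMap ℚ ℝ 7))
        · apply IsIntegral.of_pow (n := 2) (by norm_num)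
          rw [hz]
          exact_mod_cast (isIntegral_algebraMap : IsIntegral ℚ (algebraMap ℚ ℝ s))
      exact hint.isAlgebraic
  clear hx
  induction hx' using Algebra.adjoin_induction with
  | mem y hy =>
    rcases hy with rfl | rfl
    · exact ⟨0, 1, 0, 0, by simp [bqForm]⟩
    · exact ⟨0, 0, 1, 0, by simp [bqForm]⟩
  | algebraMap q => exact ⟨q, 0, 0, 0, by simp [bqForm]⟩
  | add y y' _ _ h h' =>
    obtain ⟨p, q, r, t, rfl⟩ := h
    obtain ⟨p', q', r', t', rfl⟩ := h'
    refine ⟨p+p', q+q', r+r', t+t', ?_⟩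
    simp only [bqForm]
    push_cast
    ring
  | mul y y' _ _ h h' =>
    obtain ⟨p, q, r, t, rfl⟩ := h
    obtain ⟨p', q', r', t', rfl⟩ := h'
    obtain ⟨A, B, C, D, h⟩ := bq_mul s p q r t p' q' r' t'
    exact ⟨A, B, C, D, h _ _ hw hz⟩

lemma no_five (s : ℕ) (hs4 : s % 4 = 2) (hsf : Squarefree s) (hs10 : 10 ≤ s) (h7 : ¬ (7 ∣ s)) :
    ¬ SumOfSquaresLen (ringOfInt 7 (s : ℝ)) 5 ((1 : ℝ) ^ 2 + 1 ^ 2 + 1 ^ 2 + (1 + Real.sqrt 7) ^ 2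
          + ((Real.sqrt s + Real.sqrt (7 * s)) / 2) ^ 2
          + (1 + (Real.sqrt s + Real.sqrt (7 * s)) / 2) ^ 2) := by
  rintro ⟨x, hx, hsum⟩
  have p7 : Nat.Prime 7 := by norm_num
  have h7s : Squarefree (7 * s) :=
    (Nat.squarefree_mul ((Nat.Prime.coprime_iff_not_dvd p7).2 h7)).2 ⟨p7.prime.squarefree, hsf⟩
  have hw : (Real.sqrt 7)^2 = 7 := Real.sq_sqrt (by norm_num)
  have hz : (Real.sqrt s)^2 = s := Real.sq_sqrt (by positivity)
  rw [Real.sqrt_mul (by norm_num)] at hsum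
  have hform : ∀ i, ∃ a b c d : ℤ,
      x i = a + b * Real.sqrt 7 + Real.sqrt s * (c + d * ((1 + Real.sqrt 7)/2)) := by
    intro i
    obtain ⟨hK, hI⟩ := hx i
    obtain ⟨p, q, r, t, hf⟩ := bq_field s _ hK
    rw [hf] at hI ⊢
    exact bq_int s hs4 hsf h7s _ _ hw hz p q r t hI
  choose a b c d hf using hform
  generalize Real.sqrt 7 = w at *
  generalize Real.sqrt (s:ℝ) = z at *
  have e : ∀ i, x i ^ 2 = (a i^2+7*b i^2 : ℝ) + s * (2*d i^2+c i*d i+c i^2 : ℝ)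
      + (2 * (a i * b i : ℝ) + s / 2 * ((d i+2*c i)*d i : ℝ)) * w
      + (a i*(d i+2*c i)+7*b i*d i : ℝ) * z + (a i*d i+b i*(d i+2*c i) : ℝ) * (w * z) := by
    intro i
    rw [hf i, ← hz]
    linear_combination ((b i:ℝ)^2 + b i * d i * z + z^2*d i^2/4) * hw
  simp only [e, Finset.sum_add_distrib, ← Finset.sum_mul, ← Finset.mul_sum] at hsum
  obtain ⟨g1, g2, g3, g4⟩ := bq_indep s hsf (by omega) h7s w z hw hz
    ((∑ i, (a i^2+7*b i^2) + s * ∑ i, (2*d i^2+c i*d i+c i^2) : ℤ) - (12 + 4 * s))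
    (2 * (∑ i, a i * b i : ℤ) + s / 2 * (∑ i, (d i+2*c i)*d i : ℤ) - (2 + s))
    ((∑ i, (a i*(d i+2*c i)+7*b i*d i) : ℤ) - 1)
    ((∑ i, (a i*d i+b i*(d i+2*c i)) : ℤ) - 1) (by
      simp only [bqForm]
      push_cast
      simp only [Finset.sum_add_distrib, ← Finset.mul_sum]
      rw [← hz] at hsum ⊢
      linear_combination (-1) * hsum + (1 + z^2/2) * hw)
  apply core5 s (by omega) (by omega) a b c d
  · have : ((∑ i, (a i^2+7*b i^2) + s * ∑ i, (2*d i^2+c i*d i+c i^2) : ℤ) : ℚ)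
      = ((12 + 4 * s : ℤ) : ℚ) := by rw [sub_eq_zero.1 g1]; push_cast; ring
    exact_mod_cast this
  · have : ((4 * ∑ i, a i * b i + s * ∑ i, (d i+2*c i)*d i : ℤ) : ℚ) = ((4 + 2 * s : ℤ) : ℚ) := by
      rw [Int.cast_add, Int.cast_mul, Int.cast_mul]
      push_cast at g2 ⊢
      linarith
    exact_mod_cast this
  · exact_mod_cast sub_eq_zero.1 g3
  · exact_mod_cast sub_eq_zero.1 g4

lemma pad (S : Set ℝ) (h0 : (0:ℝ) ∈ S) (α : ℝ) (k n : ℕ) (hkn : k ≤ n)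
    (h : SumOfSquaresLen S k α) : SumOfSquaresLen S n α := by
  induction n, hkn using Nat.le_induction with
  | base => exact h
  | succ n _ ih =>
    obtain ⟨x, hx, hs⟩ := ih
    refine ⟨Fin.cons 0 x, ?_, ?_⟩
    · intro i
      refine Fin.cases ?_ ?_ i
      · simpa using h0
      · intro j; simpa using hx j
    · rw [Fin.sum_univ_succ]
      simpa using hs

lemma six_sq (s : ℕ) (hs4 : s % 4 = 2) :
    SumOfSquaresLen (ringOfInt 7 (s : ℝ)) 6 ((1 : ℝ) ^ 2 + 1 ^ 2 + 1 ^ 2 + (1 + Real.sqrt 7) ^ 2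
          + ((Real.sqrt s + Real.sqrt (7 * s)) / 2) ^ 2
          + (1 + (Real.sqrt s + Real.sqrt (7 * s)) / 2) ^ 2) := by
  have hw : (Real.sqrt 7)^2 = 7 := Real.sq_sqrt (by norm_num)
  have hz : (Real.sqrt s)^2 = s := Real.sq_sqrt (by positivity)
  rw [Real.sqrt_mul (by norm_num)]
  have kw : Real.sqrt 7 ∈ biquadField 7 (s:ℝ) := IntermediateField.subset_adjoin _ _ (by simp)
  have kz : Real.sqrt s ∈ biquadField 7 (s:ℝ) := IntermediateField.subset_adjoin _ _ (by simp)
  have iw : IsIntegral ℤ (Real.sqrt 7) := by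
    apply IsIntegral.of_pow (n := 2) (by norm_num)
    rw [hw]
    exact_mod_cast (isIntegral_algebraMap : IsIntegral ℤ (algebraMap ℤ ℝ 7))
  have ib : IsIntegral ℤ ((Real.sqrt s + Real.sqrt 7 * Real.sqrt s) / 2) := by
    apply IsIntegral.of_pow (n := 2) (by norm_num)
    obtain ⟨k, hk⟩ : ∃ k, s = 2 * k := ⟨s/2, by omega⟩
    have hk' : (s:ℝ) = 2 * k := by exact_mod_cast hk
    have e : ((Real.sqrt s + Real.sqrt 7 * Real.sqrt s) / 2)^2 = ((4 * k : ℤ) : ℝ) + ((k:ℤ):ℝ) * Real.sqrt 7 := by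
      push_cast
      linear_combination (1 + Real.sqrt 7)^2/4 * hz + (s:ℝ)/4 * hw + (8 + 2 * Real.sqrt 7)/4 * hk'
    rw [e]
    exact (isIntegral_algebraMap (R := ℤ) (x := (4*k:ℤ))).add
      ((isIntegral_algebraMap (R := ℤ) (x := (k:ℤ))).mul iw)
  have kb : (Real.sqrt s + Real.sqrt 7 * Real.sqrt s) / 2 ∈ biquadField 7 (s:ℝ) :=
    div_mem (add_mem kz (mul_mem kw kz)) (ofNat_mem _ 2)
  have m1 : (1:ℝ) ∈ ringOfInt 7 (s:ℝ) := ⟨one_mem _, isIntegral_one⟩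
  have m2 : 1 + Real.sqrt 7 ∈ ringOfInt 7 (s:ℝ) := ⟨add_mem (one_mem _) kw, isIntegral_one.add iw⟩
  have m3 : (Real.sqrt s + Real.sqrt 7 * Real.sqrt s) / 2 ∈ ringOfInt 7 (s:ℝ) := ⟨kb, ib⟩
  have m4 : 1 + (Real.sqrt s + Real.sqrt 7 * Real.sqrt s) / 2 ∈ ringOfInt 7 (s:ℝ) :=
    ⟨add_mem (one_mem _) kb, isIntegral_one.add ib⟩
  refine ⟨![1, 1, 1, 1 + Real.sqrt 7, (Real.sqrt s + Real.sqrt 7 * Real.sqrt s) / 2,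
    1 + (Real.sqrt s + Real.sqrt 7 * Real.sqrt s) / 2], ?_, ?_⟩
  · intro i
    fin_cases i
    exacts [m1, m1, m1, m2, m3, m4]
  · rw [Fin.sum_univ_six]
    rfl

theorem m7_s2_length_six (s : ℕ) (hs4 : s % 4 = 2) (hsf : Squarefree s)
    (hs10 : 10 ≤ s) (h7 : ¬ (7 ∣ s)) :
    sqLength (ringOfInt 7 (s : ℝ))
        ((1 : ℝ) ^ 2 + 1 ^ 2 + 1 ^ 2 + (1 + Real.sqrt 7) ^ 2
          + ((Real.sqrt s + Real.sqrt (7 * s)) / 2) ^ 2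
          + (1 + (Real.sqrt s + Real.sqrt (7 * s)) / 2) ^ 2) = 6 ∧
    6 ≤ pythagorasNumber (ringOfInt 7 (s : ℝ)) := by
  have h6 := six_sq s hs4
  have hlen : sqLength (ringOfInt 7 (s : ℝ))
        ((1 : ℝ) ^ 2 + 1 ^ 2 + 1 ^ 2 + (1 + Real.sqrt 7) ^ 2
          + ((Real.sqrt s + Real.sqrt (7 * s)) / 2) ^ 2
          + (1 + (Real.sqrt s + Real.sqrt (7 * s)) / 2) ^ 2) = 6 := by
    apply le_antisymm
    · exact sInf_le ⟨6, rfl, h6⟩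
    · apply le_sInf
      rintro n ⟨k, rfl, hk⟩
      by_contra hlt
      have hk5 : k ≤ 5 := by
        by_contra h
        apply hlt
        have : 6 ≤ k := by omega
        exact_mod_cast this
      exact no_five s hs4 hsf hs10 h7
        (pad _ (show (0:ℝ) ∈ ringOfInt 7 (s:ℝ) from ⟨zero_mem _, isIntegral_zero⟩) _ k 5 hk5 hk)
  refine ⟨hlen, ?_⟩
  apply le_sSup
  exact ⟨_, ⟨6, h6⟩, hlen.symm⟩
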